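/- Let φ : E → (-∞,∞] satisfy Assumption (SC) with parameter μ > 0, let f : E → ℝ be anisotropically smooth relative to φ with constant L > 0, let g be proper, lower semicontinuous and prox-bounded with threshold γ_g > γ/μ, and suppose F = f + g is bounded below by F⋆. Let {x^k} be generated by y^k = x^k − γ ∇φ*(∇f(x^k)), x^{k+1} ∈ argmin_x { g(x) + (γ⋆φ)(x − y^k) } with x⁰ ∈ dom g and stepsize γ ≤ 1/L. Then the sufficient decrease F(x^{k+1}) ≤ F(x^k) − γ 𝒢^φ_γ(x^k) holds for all k, every limit point of {x^k} is a stationary point of F, and min_{0 ≤ k ≤ K−1} 𝒢^φ_γ(x^k) ≤ (F(x⁰) − F⋆)/(γK). -/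

import Mathlib

open Filter Topology Set
open scoped RealInnerProductSpace Pointwise

noncomputable section

/-- Effective domain of an extended-real-valued function. -/
def edom {α : Type*} (φ : α → EReal) : Set α := {x | φ x ≠ ⊤}

/-- Epi-scaling `(γ ⋆ φ)(x) = γ φ(x/γ)` (for `γ > 0`). -/
noncomputable def escale {α : Type*} [SMul ℝ α] (γ : ℝ) (φ : α → EReal) (x : α) : EReal :=
  (γ : EReal) * φ (γ⁻¹ • x)

variable {E : Type*} [NormedAddCommGroup E] [InnerProductSpace ℝ E] [FiniteDimensional ℝ E]

/-- Convex conjugate of an extended-real-valued function on a Euclidean space. -/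
noncomputable def econj (φ : E → EReal) (y : E) : EReal :=
  ⨆ x : E, ((⟪y, x⟫ : ℝ) : EReal) - φ x

/-- Assumption (SC): `φ` is proper, lsc, `μ`-strongly convex, even, nonnegative with `φ 0 = 0`,
has nonempty interior of domain, is `C¹` there, and its gradient blows up at the boundary. -/
structure SC (φ : E → EReal) (μ : ℝ) : Prop where
  proper : ∃ x, φ x ≠ ⊤
  nobot : ∀ x, φ x ≠ ⊥
  lsc : LowerSemicontinuous φ
  strconv : ∀ x y : E, ∀ t : ℝ, 0 ≤ t → t ≤ 1 →
    φ (t • x + (1 - t) • y) ≤ (t : EReal) * φ x + ((1 - t : ℝ) : EReal) * φ y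
      - (((μ / 2) * (t * (1 - t)) * ‖x - y‖ ^ 2 : ℝ) : EReal)
  even : ∀ x, φ (-x) = φ x
  nonneg : ∀ x, 0 ≤ φ x
  zero : φ 0 = 0
  int_nonempty : (interior (edom φ)).Nonempty
  smooth : ∃ G : E → E,
    (∀ x ∈ interior (edom φ), HasGradientAt (fun z => (φ z).toReal) (G x) x) ∧
    ContinuousOn G (interior (edom φ)) ∧
    ∀ (xs : ℕ → E) (b : E), (∀ k, xs k ∈ interior (edom φ)) →
      b ∈ frontier (edom φ) → Tendsto xs atTop (𝓝 b) →
      Tendsto (fun k => ‖G (xs k)‖) atTop atTop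

/-- `∇φ*`, the (nonlinear) preconditioner. -/
noncomputable def gradConj (φ : E → EReal) (y : E) : E :=
  gradient (fun x => (econj φ x).toReal) y

/-- Real-valued version of `φ*` (finite under Assumption (SC)). -/
noncomputable def realConj (φ : E → EReal) (y : E) : ℝ := (econj φ y).toReal

/-- Bregman divergence of `φ*`. -/
noncomputable def bregConj (φ : E → EReal) (a b : E) : ℝ :=
  realConj φ a - realConj φ b - ⟪gradConj φ b, a - b⟫

/-- `g + (1/(2γ))‖· - x̄‖²` is bounded below for some `x̄`. -/
def ProxBoundedWith (g : E → EReal) (γ : ℝ) : Prop :=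
  ∃ (xb : E) (β : ℝ), ∀ x, (β : EReal) ≤ g x + ((1 / (2 * γ) * ‖x - xb‖ ^ 2 : ℝ) : EReal)

/-- Anisotropic Moreau envelope `g^φ_γ`. -/
noncomputable def aMoreau (φ g : E → EReal) (γ : ℝ) (y : E) : EReal :=
  ⨅ x : E, g x + escale γ φ (x - y)

/-- Fréchet (regular) subdifferential. -/
def frechetSubdiff (g : E → EReal) (x : E) : Set E :=
  {v | g x ≠ ⊤ ∧ g x ≠ ⊥ ∧ ∀ ε : ℝ, 0 < ε →
    ∀ᶠ y in 𝓝 x, g x + ((⟪v, y - x⟫ - ε * ‖y - x‖ : ℝ) : EReal) ≤ g y}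

/-- Limiting (Mordukhovich) subdifferential. -/
def limitingSubdiff (g : E → EReal) (x : E) : Set E :=
  {v | ∃ xs : ℕ → E, ∃ vs : ℕ → E,
    Tendsto xs atTop (𝓝 x) ∧
    Tendsto (fun k => g (xs k)) atTop (𝓝 (g x)) ∧
    (∀ k, vs k ∈ frechetSubdiff g (xs k)) ∧
    Tendsto vs atTop (𝓝 v)}

/-- `f` is `L`-Lipschitz smooth. -/
def LipSmooth (f : E → ℝ) (L : ℝ) : Prop :=
  Differentiable ℝ f ∧ ∀ x y : E, ‖gradient f x - gradient f y‖ ≤ L * ‖x - y‖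

/-- Anisotropic smoothness of `f` relative to `φ` with constant `L`. -/
def AnisoSmooth (φ : E → EReal) (f : E → ℝ) (L : ℝ) : Prop :=
  ∀ x xb : E,
    ((f x : ℝ) : EReal) ≤ ((f xb : ℝ) : EReal)
      + escale L⁻¹ φ (x - (xb - L⁻¹ • gradConj φ (gradient f xb)))
      - escale L⁻¹ φ (xb - (xb - L⁻¹ • gradConj φ (gradient f xb)))

/-- Regularized gap function `𝒢^φ_γ`. -/
noncomputable def gapFn (φ g : E → EReal) (f : E → ℝ) (γ : ℝ) (x : E) : EReal :=
  ((γ⁻¹ : ℝ) : EReal) * (g x + (γ : EReal) * φ (gradConj φ (gradient f x))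
    - aMoreau φ g γ (x - γ • gradConj φ (gradient f x)))



section helpers

theorem SC.coe {φ : E → EReal} {μ : ℝ} (h : SC φ μ) {x : E} (hx : φ x ≠ ⊤) :
    (((φ x).toReal : ℝ) : EReal) = φ x := EReal.coe_toReal hx (h.nobot x)

theorem SC.sconv {φ : E → EReal} {μ : ℝ} (h : SC φ μ) {x y : E} (hx : φ x ≠ ⊤) (hy : φ y ≠ ⊤)
    {t : ℝ} (h0 : 0 ≤ t) (h1 : t ≤ 1) :
    φ (t • x + (1 - t) • y) ≠ ⊤ ∧ (φ (t • x + (1 - t) • y)).toReal ≤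
      t * (φ x).toReal + (1 - t) * (φ y).toReal - (μ / 2) * (t * (1 - t)) * ‖x - y‖ ^ 2 := by
  have := h.strconv x y t h0 h1
  rw [← h.coe hx, ← h.coe hy] at this
  norm_cast at this
  have h2 : φ (t • x + (1 - t) • y) ≠ ⊤ := ne_top_of_le_ne_top (EReal.coe_ne_top _) this
  refine ⟨h2, ?_⟩
  rw [← h.coe h2] at this
  exact_mod_cast this

theorem SC.convexOn {φ : E → EReal} {μ : ℝ} (hμ : 0 < μ) (h : SC φ μ) :
    ConvexOn ℝ (edom φ) (fun z => (φ z).toReal) := by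
  refine ⟨?_, ?_⟩
  · intro x hx y hy a b ha hb hab
    obtain rfl : b = 1 - a := by linarith
    exact (h.sconv hx hy ha (by linarith)).1
  · intro x hx y hy a b ha hb hab
    obtain rfl : b = 1 - a := by linarith
    have := (h.sconv hx hy ha (by linarith)).2
    have h3 : 0 ≤ (μ / 2) * (a * (1 - a)) * ‖x - y‖ ^ 2 := by positivity
    simp only [smul_eq_mul]
    linarith

theorem SC.quad {φ : E → EReal} {μ : ℝ} (h : SC φ μ) {x : E} (hx : φ x ≠ ⊤) :
    μ / 2 * ‖x‖ ^ 2 ≤ (φ x).toReal := by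
  have h00 : φ 0 ≠ ⊤ := by rw [h.zero]; exact EReal.zero_ne_top
  have key : ∀ t : ℝ, 0 < t → t < 1 → μ / 2 * (1 - t) * ‖x‖ ^ 2 ≤ (φ x).toReal := by
    intro t ht ht1
    have h1 := (h.sconv hx h00 ht.le ht1.le).2
    have h2 : 0 ≤ (φ (t • x + (1 - t) • 0)).toReal := EReal.toReal_nonneg (h.nonneg _)
    rw [h.zero, sub_zero] at h1
    simp only [EReal.toReal_zero, mul_zero, add_zero] at h1
    have : t * (μ / 2 * (1 - t) * ‖x‖ ^ 2) ≤ t * (φ x).toReal := by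
      simp only [smul_zero, add_zero] at h1 h2
      nlinarith
    exact le_of_mul_le_mul_left this ht
  have hl : Tendsto (fun t : ℝ => μ / 2 * (1 - t) * ‖x‖ ^ 2) (𝓝[>] 0) (𝓝 (μ / 2 * ‖x‖ ^ 2)) := by
    have : Continuous (fun t : ℝ => μ / 2 * (1 - t) * ‖x‖ ^ 2) := by fun_prop
    have := (this.tendsto 0).mono_left (nhdsWithin_le_nhds (s := Ioi 0))
    simpa using this
  refine le_of_tendsto hl ?_
  filter_upwards [Ioo_mem_nhdsGT (show (0:ℝ) < 1 by norm_num)] with t ht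
  exact key t ht.1 ht.2

/-- existence of the maximizer in the conjugate -/
theorem SC.exists_min {φ : E → EReal} {μ : ℝ} (hμ : 0 < μ) (h : SC φ μ) (v : E) :
    ∃ p : E, φ p ≠ ⊤ ∧ ∀ x, φ x ≠ ⊤ →
      (φ p).toReal - ⟪v, p⟫ ≤ (φ x).toReal - ⟪v, x⟫ := by
  have h00 : φ 0 ≠ ⊤ := by rw [h.zero]; exact EReal.zero_ne_top
  have hlsc : LowerSemicontinuous (fun x => φ x + ((-⟪v, x⟫ : ℝ) : EReal)) := by
    refine LowerSemicontinuous.add' h.lsc ?_ ?_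
    · apply Continuous.lowerSemicontinuous
      exact continuous_coe_real_ereal.comp (by fun_prop)
    · intro x
      exact EReal.continuousAt_add (Or.inr (EReal.coe_ne_bot _)) (Or.inr (EReal.coe_ne_top _))
  set R : ℝ := 2 * ‖v‖ / μ with hR
  have hR0 : 0 ≤ R := by positivity
  obtain ⟨p, hp, hmin⟩ := (hlsc.lowerSemicontinuousOn (Metric.closedBall 0 R)).exists_isMinOn
    ⟨0, by simpa using hR0⟩ (isCompact_closedBall 0 R)
  have hp0 := hmin (show (0:E) ∈ Metric.closedBall 0 R by simpa using hR0)
  simp only [mem_ofPred_eq, inner_zero_right, neg_zero, EReal.coe_zero, add_zero, h.zero] at hp0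
  have hpt : φ p ≠ ⊤ := by
    intro ht
    rw [ht, EReal.top_add_coe] at hp0
    exact absurd hp0 (by simp)
  rw [← h.coe hpt] at hp0
  norm_cast at hp0
  refine ⟨p, hpt, fun x hx => ?_⟩
  by_cases hxR : ‖x‖ ≤ R
  · have := hmin (show x ∈ Metric.closedBall 0 R by simpa using hxR)
    simp only [mem_ofPred_eq] at this
    rw [← h.coe hpt, ← h.coe hx] at this
    norm_cast at this
  · push Not at hxR
    have h1 := h.quad hx
    have h2 := real_inner_le_norm v x
    have h3 : 2 * ‖v‖ < μ * ‖x‖ := by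
      rw [hR, div_lt_iff₀ hμ] at hxR; linarith
    have h4 : 0 ≤ ‖x‖ := norm_nonneg x
    nlinarith

/-- quadratic growth at the minimizer -/
theorem SC.growth {φ : E → EReal} {μ : ℝ} (h : SC φ μ) {v p : E} (hp : φ p ≠ ⊤)
    (hmin : ∀ x, φ x ≠ ⊤ → (φ p).toReal - ⟪v, p⟫ ≤ (φ x).toReal - ⟪v, x⟫)
    {x : E} (hx : φ x ≠ ⊤) :
    (φ p).toReal - ⟪v, p⟫ + μ / 2 * ‖x - p‖ ^ 2 ≤ (φ x).toReal - ⟪v, x⟫ := by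
  have key : ∀ t : ℝ, 0 < t → t < 1 →
      (φ p).toReal - ⟪v, p⟫ + μ / 2 * (1 - t) * ‖x - p‖ ^ 2 ≤ (φ x).toReal - ⟪v, x⟫ := by
    intro t ht ht1
    obtain ⟨h1, h2⟩ := h.sconv hx hp ht.le ht1.le
    have h3 := hmin _ h1
    rw [inner_add_right, inner_smul_right, inner_smul_right] at h3
    have : t * ((φ p).toReal - ⟪v, p⟫ + μ / 2 * (1 - t) * ‖x - p‖ ^ 2)
        ≤ t * ((φ x).toReal - ⟪v, x⟫) := by nlinarith
    exact le_of_mul_le_mul_left this ht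
  have hl : Tendsto (fun t : ℝ => (φ p).toReal - ⟪v, p⟫ + μ / 2 * (1 - t) * ‖x - p‖ ^ 2) (𝓝[>] 0)
      (𝓝 ((φ p).toReal - ⟪v, p⟫ + μ / 2 * ‖x - p‖ ^ 2)) := by
    have : Continuous (fun t : ℝ => (φ p).toReal - ⟪v, p⟫ + μ / 2 * (1 - t) * ‖x - p‖ ^ 2) := by
      fun_prop
    have := (this.tendsto 0).mono_left (nhdsWithin_le_nhds (s := Ioi 0))
    simpa using this
  refine le_of_tendsto hl ?_
  filter_upwards [Ioo_mem_nhdsGT (show (0:ℝ) < 1 by norm_num)] with t ht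
  exact key t ht.1 ht.2

theorem SC.econj_eq {φ : E → EReal} {μ : ℝ} (h : SC φ μ) {v p : E} (hp : φ p ≠ ⊤)
    (hmin : ∀ x, φ x ≠ ⊤ → (φ p).toReal - ⟪v, p⟫ ≤ (φ x).toReal - ⟪v, x⟫) :
    (econj φ v).toReal = ⟪v, p⟫ - (φ p).toReal := by
  have : econj φ v = ((⟪v, p⟫ - (φ p).toReal : ℝ) : EReal) := by
    apply le_antisymm
    · refine iSup_le fun x => ?_
      by_cases hx : φ x = ⊤
      · rw [hx]; simp
      · rw [← h.coe hx]
        have := hmin x hx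
        norm_cast
        linarith
    · refine le_trans ?_ (le_iSup _ p)
      rw [EReal.coe_sub, h.coe hp]
  rw [this, EReal.toReal_coe]

theorem SC.gradConj_spec {φ : E → EReal} {μ : ℝ} (hμ : 0 < μ) (h : SC φ μ) :
    Continuous (gradConj φ) ∧ ∀ v, φ (gradConj φ v) ≠ ⊤ ∧ ∀ x, φ x ≠ ⊤ →
      (φ (gradConj φ v)).toReal - ⟪v, gradConj φ v⟫ ≤ (φ x).toReal - ⟪v, x⟫ := by
  choose p hp hmin using h.exists_min hμ
  have hlip : ∀ v w, ‖p v - p w‖ ≤ ‖v - w‖ / μ := by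
    intro v w
    have h1 := h.growth (hp v) (hmin v) (hp w)
    have h2 := h.growth (hp w) (hmin w) (hp v)
    rw [norm_sub_rev] at h1
    have h3 : ⟪v - w, p v - p w⟫ = ⟪v, p v⟫ - ⟪v, p w⟫ - ⟪w, p v⟫ + ⟪w, p w⟫ := by
      rw [inner_sub_left, inner_sub_right, inner_sub_right]; ring
    have h4 := real_inner_le_norm (v - w) (p v - p w)
    rw [le_div_iff₀ hμ]
    by_cases h0 : ‖p v - p w‖ = 0
    · rw [h0]; simp
    · have : 0 < ‖p v - p w‖ := lt_of_le_of_ne (norm_nonneg _) (Ne.symm h0)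
      refine le_of_mul_le_mul_left ?_ this
      nlinarith
  have hgrad : ∀ v, HasGradientAt (fun x => (econj φ x).toReal) (p v) v := by
    intro v
    rw [hasGradientAt_iff_isLittleO]
    have hO : (fun w => (econj φ w).toReal - (econj φ v).toReal - ⟪p v, w - v⟫) =O[𝓝 v]
        fun w => ‖w - v‖ ^ 2 := by
      refine Asymptotics.IsBigO.of_bound (1 / μ) (Eventually.of_forall fun w => ?_)
      rw [h.econj_eq (hp w) (hmin w), h.econj_eq (hp v) (hmin v)]
      have h1 := hmin w (p v) (hp v)
      have h2 := hmin v (p w) (hp w)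
      have h4 := real_inner_le_norm (w - v) (p w - p v)
      have h5 := hlip w v
      have h6 : ⟪w - v, p w - p v⟫ = ⟪w, p w⟫ - ⟪w, p v⟫ - ⟪v, p w⟫ + ⟪v, p v⟫ := by
        rw [inner_sub_left, inner_sub_right, inner_sub_right]; ring
      have h7 : ⟪p v, w - v⟫ = ⟪w, p v⟫ - ⟪v, p v⟫ := by
        rw [inner_sub_right, real_inner_comm, real_inner_comm v]
      have h8 : ‖w - v‖ * ‖p w - p v‖ ≤ ‖w - v‖ * (‖w - v‖ / μ) :=
        mul_le_mul_of_nonneg_left h5 (norm_nonneg _)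
      have h9 : ‖w - v‖ * (‖w - v‖ / μ) = 1 / μ * ‖w - v‖ ^ 2 := by ring
      rw [Real.norm_eq_abs, Real.norm_eq_abs, abs_of_nonneg (sq_nonneg ‖w - v‖), abs_le]
      constructor <;> linarith [mul_nonneg (norm_nonneg (w - v)) (norm_nonneg (p w - p v)),
        show 0 ≤ 1 / μ * ‖w - v‖ ^ 2 by positivity]
    refine hO.trans_isLittleO ?_
    have := Asymptotics.isLittleO_pow_sub_sub (E' := E) v (m := 2) one_lt_two
    simpa using this
  have heq : gradConj φ = p := funext fun v => (hgrad v).gradient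
  rw [heq]
  refine ⟨?_, fun v => ⟨hp v, hmin v⟩⟩
  refine (LipschitzWith.of_dist_le_mul (K := ⟨1 / μ, by positivity⟩) fun v w => ?_).continuous
  rw [dist_eq_norm, dist_eq_norm]
  calc _ ≤ _ := hlip v w
    _ = (1 / μ) * ‖v - w‖ := by ring

theorem SC.grad_ineq {φ : E → EReal} {μ : ℝ} (hμ : 0 < μ) (h : SC φ μ) {x w G : E}
    (hx : φ x ≠ ⊤) (hG : HasGradientAt (fun z => (φ z).toReal) G x) (hw : φ w ≠ ⊤) :
    (φ x).toReal + ⟪G, w - x⟫ ≤ (φ w).toReal := by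
  have hd : HasDerivAt (fun s : ℝ => (φ (x + s • (w - x))).toReal) ⟪G, w - x⟫ 0 := by
    have h1 : HasDerivAt (fun s : ℝ => x + s • (w - x)) (w - x) 0 := by
      simpa using ((hasDerivAt_id (0:ℝ)).smul_const (w - x)).const_add x
    have h2 : HasFDerivAt (fun z => (φ z).toReal) (InnerProductSpace.toDual ℝ E G)
        (x + (0:ℝ) • (w - x)) := by
      simpa using hG.hasFDerivAt
    have h3 := h2.comp_hasDerivAt (0:ℝ) h1
    rw [InnerProductSpace.toDual_apply_apply] at h3
    exact h3
  have ht := hd.tendsto_slope_zero_right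
  have : ⟪G, w - x⟫ ≤ (φ w).toReal - (φ x).toReal := by
    refine le_of_tendsto ht ?_
    filter_upwards [Ioo_mem_nhdsGT (show (0:ℝ) < 1 by norm_num)] with t ht
    have h1 := (h.sconv hw hx ht.1.le ht.2.le).2
    have h2 : x + (0 + t) • (w - x) = t • w + (1 - t) • x := by module
    rw [h2, zero_smul, add_zero, smul_eq_mul, inv_mul_le_iff₀ ht.1]
    have h3 : 0 ≤ (μ / 2) * (t * (1 - t)) * ‖w - x‖ ^ 2 := by
      have := ht.1; have : 0 ≤ 1 - t := by linarith [ht.2]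
      positivity
    linarith
  linarith

theorem SC.min_interior {φ : E → EReal} {μ : ℝ} (hμ : 0 < μ) (h : SC φ μ) {v p : E}
    (hp : φ p ≠ ⊤)
    (hmin : ∀ x, φ x ≠ ⊤ → (φ p).toReal - ⟪v, p⟫ ≤ (φ x).toReal - ⟪v, x⟫) :
    p ∈ interior (edom φ) ∧ HasGradientAt (fun z => (φ z).toReal) v p := by
  obtain ⟨G, hG, -, hblow⟩ := h.smooth
  have hpi : p ∈ interior (edom φ) := by
    by_contra hpi
    obtain ⟨q, hq⟩ := h.int_nonempty
    have hfr : p ∈ frontier (edom φ) := ⟨subset_closure hp, hpi⟩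
    set t : ℕ → ℝ := fun k => 1 / ((k : ℝ) + 2) with ht
    have ht0 : ∀ k, 0 < t k := fun k => by simp only [ht]; positivity
    have ht1 : ∀ k, t k < 1 := fun k => by
      simp only [ht]; rw [div_lt_one (by positivity)]; linarith [(Nat.cast_nonneg k : (0:ℝ) ≤ k)]
    have htl : Tendsto t atTop (𝓝 0) := by
      refine Tendsto.div_atTop tendsto_const_nhds ?_
      exact tendsto_atTop_add_const_right _ _ tendsto_natCast_atTop_atTop
    set xs : ℕ → E := fun k => p + t k • (q - p) with hxs
    have hxi : ∀ k, xs k ∈ interior (edom φ) := by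
      intro k
      refine (h.convexOn hμ).1.openSegment_interior_self_subset_interior hq hp ?_
      refine ⟨t k, 1 - t k, ht0 k, by linarith [ht1 k], by ring, ?_⟩
      simp only [hxs]; module
    have hxl : Tendsto xs atTop (𝓝 p) := by
      have := (htl.smul_const (q - p)).const_add p
      simpa using this
    have hinf := hblow xs p hxi hfr hxl
    -- a ball around q
    have hcq : ContinuousAt (fun z => (φ z).toReal) q := (hG q hq).continuousAt
    have hev : ∀ᶠ z in 𝓝 q, z ∈ edom φ ∧ (φ z).toReal < (φ q).toReal + 1 :=
      (show ∀ᶠ z in 𝓝 q, z ∈ edom φ from mem_interior_iff_mem_nhds.1 hq).and (hcq.eventually_lt_const (by linarith))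
    obtain ⟨r, hr, hball⟩ := Metric.eventually_nhds_iff.1 hev
    have hbd : ∀ k, ‖G (xs k)‖ ≤ ((φ q).toReal + 1 + ‖v‖ * ‖q - p‖) / (r / 2) := by
      intro k
      have hxk : φ (xs k) ≠ ⊤ := interior_subset (hxi k)
      set g := G (xs k) with hg
      have hg' := hG _ (hxi k)
      rw [← hg] at hg'
      have hq0 : 0 ≤ (φ q).toReal := EReal.toReal_nonneg (h.nonneg _)
      by_cases hg0 : ‖g‖ = 0
      · rw [hg0]; positivity
      have hgp : 0 < ‖g‖ := lt_of_le_of_ne (norm_nonneg _) (Ne.symm hg0)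
      rw [le_div_iff₀ (by positivity)]
      set e : E := (r / 2 / ‖g‖) • g with he
      have hen : ‖e‖ = r / 2 := by
        rw [he, norm_smul, Real.norm_of_nonneg (by positivity)]; field_simp
      have hge : ⟪g, e⟫ = ‖g‖ * (r / 2) := by
        rw [he, inner_smul_right, real_inner_self_eq_norm_sq]; field_simp
      obtain ⟨hz1, hz2⟩ := hball (y := q + e) (by rw [dist_eq_norm]; simp [hen]; linarith)
      have i1 := h.grad_ineq hμ hxk hg' hz1
      have i2 := h.grad_ineq hμ hxk hg' hp
      have i3 := hmin _ hxk
      have j0 : 0 ≤ (φ (xs k)).toReal := EReal.toReal_nonneg (h.nonneg _)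
      have e1 : q + e - xs k = (1 - t k) • (q - p) + e := by simp only [hxs]; module
      have e2 : p - xs k = - (t k • (q - p)) := by simp only [hxs]; module
      rw [e1, inner_add_right, inner_smul_right, hge] at i1
      rw [e2, inner_neg_right, inner_smul_right] at i2
      have e3 : ⟪v, xs k⟫ = ⟪v, p⟫ + t k * ⟪v, q - p⟫ := by
        simp only [hxs]; rw [inner_add_right, inner_smul_right]
      rw [e3] at i3
      have i4 : ⟪v, q - p⟫ ≤ ⟪g, q - p⟫ := by
        refine le_of_mul_le_mul_left ?_ (ht0 k); linarith
      have i5 : -(‖v‖ * ‖q - p‖) ≤ ⟪v, q - p⟫ := by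
        have := abs_real_inner_le_norm v (q - p); exact (abs_le.1 this).1
      have i6 : -(‖v‖ * ‖q - p‖) ≤ (1 - t k) * ⟪g, q - p⟫ := by
        have a1 : 0 ≤ ‖v‖ * ‖q - p‖ := by positivity
        have a2 := ht0 k
        have a3 := ht1 k
        nlinarith
      linarith
    obtain ⟨k, hk⟩ := (hinf.eventually_gt_atTop
      (((φ q).toReal + 1 + ‖v‖ * ‖q - p‖) / (r / 2))).exists
    exact absurd (hbd k) (not_le.2 hk)
  refine ⟨hpi, ?_⟩
  have hg := hG p hpi
  suffices G p = v by rwa [this] at hg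
  have hloc : IsLocalMin (fun z => (φ z).toReal - ⟪v, z⟫) p := by
    filter_upwards [mem_interior_iff_mem_nhds.1 hpi] with z hz using hmin z hz
  have hd : HasFDerivAt (fun z => (φ z).toReal - ⟪v, z⟫)
      (InnerProductSpace.toDual ℝ E (G p) - InnerProductSpace.toDual ℝ E v) p :=
    hg.hasFDerivAt.sub (InnerProductSpace.toDual ℝ E v).hasFDerivAt
  have := hloc.hasFDerivAt_eq_zero hd
  rw [← map_sub, map_eq_zero_iff _ (InnerProductSpace.toDual ℝ E).injective] at this
  exact sub_eq_zero.1 this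

end helpers

/-- Convergence of the deterministic anisotropic proximal gradient method:
sufficient decrease, stationarity of limit points, and the `O(1/K)` rate for the best gap. -/
theorem aniso_prox_grad_convergence (φ g : E → EReal) (f : E → ℝ) (μ L γ γg Fstar : ℝ)
    (hμ : 0 < μ) (hSC : SC φ μ)
    (hf : ContDiff ℝ 1 f) (hL : 0 < L) (haniso : AnisoSmooth φ f L)
    (hg_proper : ∃ x, g x ≠ ⊤) (hg_nobot : ∀ x, g x ≠ ⊥) (hg_lsc : LowerSemicontinuous g)
    (hγg : γ / μ < γg) (hprox : ∀ γ' : ℝ, 0 < γ' → γ' < γg → ProxBoundedWith g γ')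
    (hγ : 0 < γ) (hγL : γ ≤ 1 / L)
    (hFbdd : ∀ x : E, (Fstar : EReal) ≤ (f x : ℝ) + g x)
    (x : ℕ → E) (hx0 : x 0 ∈ edom g)
    (hupdate : ∀ (k : ℕ) (z : E),
      g (x (k + 1)) + escale γ φ (x (k + 1) - (x k - γ • gradConj φ (gradient f (x k))))
        ≤ g z + escale γ φ (z - (x k - γ • gradConj φ (gradient f (x k))))) :
    (∀ k : ℕ, ((f (x (k + 1)) : ℝ) : EReal) + g (x (k + 1))
        ≤ ((f (x k) : ℝ) : EReal) + g (x k) - (γ : EReal) * gapFn φ g f γ (x k)) ∧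
    (∀ z : E, (∃ ι : ℕ → ℕ, StrictMono ι ∧ Tendsto (fun j => x (ι j)) atTop (𝓝 z)) →
      -gradient f z ∈ limitingSubdiff g z) ∧
    ∀ K : ℕ, 0 < K → ∃ k, k < K ∧
      gapFn φ g f γ (x k)
        ≤ (((f (x 0) : ℝ) : EReal) + g (x 0) - (Fstar : EReal)) / ((γ * K : ℝ) : EReal) := by
  obtain ⟨hcont, hspec⟩ := hSC.gradConj_spec hμ
  have hgc : ∀ {w}, g w ≠ ⊤ → (((g w).toReal : ℝ) : EReal) = g w :=
    fun hw => EReal.coe_toReal hw (hg_nobot _)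
  set u : ℕ → E := fun k => gradConj φ (gradient f (x k)) with hu
  have hut : ∀ k, φ (u k) ≠ ⊤ := fun k => (hspec _).1
  have hself : ∀ k, γ⁻¹ • (x k - (x k - γ • u k)) = u k := by
    intro k; rw [sub_sub_cancel, smul_smul, inv_mul_cancel₀ hγ.ne', one_smul]
  have hesc : ∀ w, escale γ φ w = (γ : EReal) * φ (γ⁻¹ • w) := fun w => rfl
  -- finiteness along the iteration
  have hsplit : ∀ k, g (x k) ≠ ⊤ →
      g (x (k + 1)) ≠ ⊤ ∧ φ (γ⁻¹ • (x (k + 1) - (x k - γ • u k))) ≠ ⊤ := by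
    intro k hk
    have h1 := hupdate k (x k)
    change g (x (k + 1)) + escale γ φ (x (k + 1) - (x k - γ • u k))
      ≤ g (x k) + escale γ φ (x k - (x k - γ • u k)) at h1
    rw [hesc, hesc, hself, ← hgc hk, ← hSC.coe (hut k)] at h1
    norm_cast at h1
    have h2 := ne_top_of_le_ne_top (EReal.coe_ne_top _) h1
    constructor
    · intro ht
      apply h2
      rw [ht]
      refine EReal.top_add_of_ne_bot ?_
      refine ne_bot_of_le_ne_bot EReal.zero_ne_bot
        (mul_nonneg (EReal.coe_nonneg.2 hγ.le) (hSC.nonneg _))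
    · intro ht
      apply h2
      rw [ht, EReal.coe_mul_top_of_pos hγ]
      exact EReal.add_top_of_ne_bot (hg_nobot _)
  have hgt : ∀ k, g (x k) ≠ ⊤ := by
    intro k
    induction k with
    | zero => exact hx0
    | succ n ih => exact (hsplit n ih).1
  set a : ℕ → ℝ := fun k => (g (x k)).toReal with ha
  have hac : ∀ k, g (x k) = (a k : EReal) := fun k => (hgc (hgt k)).symm
  set b : ℕ → ℝ := fun k => (φ (u k)).toReal with hb
  have hbc : ∀ k, φ (u k) = (b k : EReal) := fun k => (hSC.coe (hut k)).symm
  set c : ℕ → ℝ := fun k => (φ (γ⁻¹ • (x (k + 1) - (x k - γ • u k)))).toReal with hc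
  have hcc : ∀ k, φ (γ⁻¹ • (x (k + 1) - (x k - γ • u k))) = (c k : EReal) :=
    fun k => (hSC.coe (hsplit k (hgt k)).2).symm
  have hup : ∀ k w, g w ≠ ⊤ → φ (γ⁻¹ • (w - (x k - γ • u k))) ≠ ⊤ →
      a (k + 1) + γ * c k ≤ (g w).toReal + γ * (φ (γ⁻¹ • (w - (x k - γ • u k)))).toReal := by
    intro k w hw hw'
    have h1 := hupdate k w
    change g (x (k + 1)) + escale γ φ (x (k + 1) - (x k - γ • u k))
      ≤ g w + escale γ φ (w - (x k - γ • u k)) at h1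
    rw [hesc, hesc, hcc, hac, ← hgc hw, ← hSC.coe hw'] at h1
    exact_mod_cast h1
  have henv : ∀ k, aMoreau φ g γ (x k - γ • u k) = ((a (k + 1) + γ * c k : ℝ) : EReal) := by
    intro k
    have h0 : g (x (k + 1)) + escale γ φ (x (k + 1) - (x k - γ • u k))
        = ((a (k + 1) + γ * c k : ℝ) : EReal) := by
      rw [hesc, hcc, hac]; norm_cast
    rw [← h0]
    exact le_antisymm (iInf_le _ (x (k + 1))) (le_iInf fun w => hupdate k w)
  set d : ℕ → ℝ := fun k => a k + γ * b k - (a (k + 1) + γ * c k) with hd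
  have hgap : ∀ k, gapFn φ g f γ (x k) = ((γ⁻¹ * d k : ℝ) : EReal) := by
    intro k
    change ((γ⁻¹ : ℝ) : EReal) * (g (x k) + (γ : EReal) * φ (u k)
      - aMoreau φ g γ (x k - γ • u k)) = _
    rw [henv, hac, hbc]
    norm_cast
  have hdnn : ∀ k, 0 ≤ d k := by
    intro k
    have := hup k (x k) (hgt k) (by rw [hself]; exact hut k)
    rw [hself] at this
    simp only [hd]
    change a (k + 1) + γ * c k ≤ a k + γ * b k at this
    linarith
  -- real sufficient decrease
  have hdec : ∀ k, f (x (k + 1)) + a (k + 1) ≤ f (x k) + a k - d k := by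
    intro k
    have hLi : 0 < L⁻¹ := inv_pos.2 hL
    have h1 := haniso (x (k + 1)) (x k)
    change ((f (x (k + 1)) : ℝ) : EReal) ≤ ((f (x k) : ℝ) : EReal)
      + escale L⁻¹ φ (x (k + 1) - (x k - L⁻¹ • u k))
      - escale L⁻¹ φ (x k - (x k - L⁻¹ • u k)) at h1
    have e1 : (L⁻¹)⁻¹ • (x k - (x k - L⁻¹ • u k)) = u k := by
      rw [sub_sub_cancel, smul_smul, inv_mul_cancel₀ hLi.ne', one_smul]
    have hs0 : 0 ≤ γ * L := by positivity
    have hs1 : γ * L ≤ 1 := by rwa [le_div_iff₀ hL] at hγL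
    have e2 : (L⁻¹)⁻¹ • (x (k + 1) - (x k - L⁻¹ • u k))
        = (γ * L) • (γ⁻¹ • (x (k + 1) - (x k - γ • u k))) + (1 - γ * L) • u k := by
      rw [inv_inv, smul_smul]
      have : γ * L * γ⁻¹ = L := by field_simp
      rw [this, smul_sub, smul_sub, smul_sub, smul_sub, smul_smul, smul_smul,
        mul_inv_cancel₀ hL.ne', one_smul, sub_smul, one_smul, mul_comm L γ]
      abel
    obtain ⟨h2, h3⟩ := hSC.sconv (hsplit k (hgt k)).2 (hut k) hs0 hs1
    unfold escale at h1
    rw [e1, e2, ← hSC.coe h2, hbc] at h1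
    norm_cast at h1
    have h4 : 0 ≤ (μ / 2) * (γ * L * (1 - γ * L)) *
        ‖γ⁻¹ • (x (k + 1) - (x k - γ • u k)) - u k‖ ^ 2 := by
      have : 0 ≤ 1 - γ * L := by linarith
      positivity
    have h5 : (φ ((γ * L) • (γ⁻¹ • (x (k + 1) - (x k - γ • u k))) + (1 - γ * L) • u k)).toReal
        ≤ γ * L * c k + (1 - γ * L) * b k := by
      linarith
    have h6 := mul_le_mul_of_nonneg_left h5 hLi.le
    have h7 : L⁻¹ * (γ * L * c k + (1 - γ * L) * b k) = γ * c k + L⁻¹ * b k - γ * b k := by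
      field_simp; ring
    simp only [hd]
    linarith
  have hFs : ∀ k, Fstar ≤ f (x k) + a k := by
    intro k
    have := hFbdd (x k)
    rw [hac] at this
    exact_mod_cast this
  have htele : ∀ n, f (x n) + a n + ∑ k ∈ Finset.range n, d k ≤ f (x 0) + a 0 := by
    intro n
    induction n with
    | zero => simp
    | succ n ih => rw [Finset.sum_range_succ]; linarith [hdec n]
  have hsum : ∀ n, ∑ k ∈ Finset.range n, d k ≤ f (x 0) + a 0 - Fstar := fun n => by
    linarith [htele n, hFs n]
  have hd0 : Tendsto d atTop (𝓝 0) :=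
    (summable_of_sum_range_le hdnn hsum).tendsto_atTop_zero
  refine ⟨?_, ?_, ?_⟩
  · intro k
    rw [hgap, hac, hac]
    have : (γ : EReal) * ((γ⁻¹ * d k : ℝ) : EReal) = ((d k : ℝ) : EReal) := by
      rw [← EReal.coe_mul, mul_inv_cancel_left₀ hγ.ne']
    rw [this]
    exact_mod_cast hdec k
  · rintro z ⟨ι, hι, hz⟩
    have hιt := hι.tendsto_atTop
    have hgradc : Continuous (gradient f) :=
      (InnerProductSpace.toDual ℝ E).symm.continuous.comp (hf.continuous_fderiv one_ne_zero)
    set v := gradient f z with hv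
    set ub := gradConj φ v with hub
    have hul : Tendsto (fun j => u (ι j)) atTop (𝓝 ub) :=
      ((hcont.comp hgradc).tendsto z).comp hz
    obtain ⟨hint, hgrad⟩ := hSC.min_interior hμ (hspec v).1 (hspec v).2
    obtain ⟨G, hG, -, -⟩ := hSC.smooth
    have hlim : ∀ (r : ℕ → ℝ) (l : ℝ), Tendsto r atTop (𝓝 l) → (∀ᶠ j in atTop, a (ι j) ≤ r j) →
        g z ≤ (l : EReal) := by
      intro r l hr hle
      by_contra hcon
      push Not at hcon
      obtain ⟨m, hm1, hm2⟩ := EReal.exists_between_coe_real hcon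
      have h1 := hz.eventually (hg_lsc z m hm2)
      have h2 := hr.eventually_lt_const (EReal.coe_lt_coe_iff.1 hm1)
      obtain ⟨j, h1, h2, h3⟩ := (h1.and (h2.and hle)).exists
      rw [hac] at h1
      have := EReal.coe_lt_coe_iff.1 h1
      linarith
    have hfz : Tendsto (fun j => f (x (ι j))) atTop (𝓝 (f z)) := (hf.continuous.tendsto z).comp hz
    have hgz : g z ≠ ⊤ := by
      refine ne_top_of_le_ne_top (EReal.coe_ne_top _)
        (hlim (fun j => f (x 0) + a 0 - f (x (ι j))) _ (hfz.const_sub _) (Eventually.of_forall ?_))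
      intro j
      have h1 := htele (ι j)
      have h2 := Finset.sum_nonneg (s := Finset.range (ι j)) (fun k _ => hdnn k)
      linarith
    have hcb : ContinuousAt (fun w => (φ w).toReal) ub := hgrad.continuousAt
    -- local minimality of z
    have hmap : Tendsto (fun w => ub + γ⁻¹ • (w - z)) (𝓝 z) (𝓝 ub) := by
      have : Continuous (fun w => ub + γ⁻¹ • (w - z)) := by fun_prop
      simpa using this.tendsto z
    have hloc : ∀ w, g w ≠ ⊤ → ub + γ⁻¹ • (w - z) ∈ interior (edom φ) →
        (g z).toReal ≤ (g w).toReal + γ * (φ (ub + γ⁻¹ • (w - z))).toReal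
          - γ * (φ ub).toReal := by
      intro w hw hwi
      have hq : Tendsto (fun j => γ⁻¹ • (w - (x (ι j) - γ • u (ι j)))) atTop
          (𝓝 (ub + γ⁻¹ • (w - z))) := by
        have h1 : Tendsto (fun j => γ⁻¹ • (w - (x (ι j) - γ • u (ι j)))) atTop
          (𝓝 (γ⁻¹ • (w - (z - γ • ub)))) :=
          ((hz.sub (hul.const_smul γ)).const_sub w).const_smul γ⁻¹
        have h2 : γ⁻¹ • (w - (z - γ • ub)) = ub + γ⁻¹ • (w - z) := by
          rw [sub_sub_eq_add_sub, add_sub_right_comm, smul_add, smul_smul,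
            inv_mul_cancel₀ hγ.ne', one_smul, add_comm]
        rwa [h2] at h1
      have hφq := (hG _ hwi).continuousAt.tendsto.comp hq
      have hφu := hcb.tendsto.comp hul
      have hdl := hd0.comp hιt
      have hR := (((hφq.const_mul γ).const_add (g w).toReal).sub (hφu.const_mul γ)).add hdl
      have := hlim _ _ hR ?_
      · rw [← hgc hgz] at this
        have := EReal.coe_le_coe_iff.1 this
        linarith
      · filter_upwards [hq.eventually (isOpen_interior.mem_nhds hwi)] with j hj
        have h1 := hup (ι j) w hw (interior_subset hj)
        simp only [Function.comp]
        simp only [hd]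
        change _ ≤ (g w).toReal + γ * (φ (γ⁻¹ • (w - (x (ι j) - γ • u (ι j))))).toReal
          - γ * b (ι j) + (a (ι j) + γ * b (ι j) - (a (ι j + 1) + γ * c (ι j)))
        linarith
    have hfre : -v ∈ frechetSubdiff g z := by
      refine ⟨hgz, hg_nobot z, fun ε hε => ?_⟩
      have ho := (hasGradientAt_iff_isLittleO.1 hgrad).def hε
      filter_upwards [hmap.eventually ho, hmap.eventually (isOpen_interior.mem_nhds hint)]
        with w h1 h2
      by_cases hw : g w = ⊤
      · rw [hw]; exact le_top
      have h3 := hloc w hw h2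
      rw [← hgc hgz, ← hgc hw]
      norm_cast
      rw [add_sub_cancel_left, inner_smul_right, norm_smul, Real.norm_of_nonneg (inv_pos.2 hγ).le,
        Real.norm_eq_abs] at h1
      have h4 := mul_le_mul_of_nonneg_left (le_of_abs_le h1) hγ.le
      have h5 : γ * (ε * (γ⁻¹ * ‖w - z‖)) = ε * ‖w - z‖ := by field_simp
      have h6 : γ * (γ⁻¹ * ⟪v, w - z⟫) = ⟪v, w - z⟫ := by field_simp
      rw [h5, mul_sub, mul_sub, h6] at h4
      rw [inner_neg_left]
      linarith
    exact ⟨fun _ => z, fun _ => -v, tendsto_const_nhds, tendsto_const_nhds, fun _ => hfre,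
      tendsto_const_nhds⟩
  · intro K hK
    have hKr : (0 : ℝ) < K := Nat.cast_pos.2 hK
    obtain ⟨k, hk, hle⟩ := Finset.exists_le_of_sum_le (s := Finset.range K) (f := d)
      (g := fun _ => (f (x 0) + a 0 - Fstar) / K) ⟨0, Finset.mem_range.2 hK⟩ (by
        rw [Finset.sum_const, Finset.card_range, nsmul_eq_mul, mul_div_cancel₀ _ hKr.ne']
        exact hsum K)
    refine ⟨k, Finset.mem_range.1 hk, ?_⟩
    rw [hgap, hac]
    have e : ((f (x 0) : ℝ) : EReal) + (a 0 : EReal) - (Fstar : EReal)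
      = ((f (x 0) + a 0 - Fstar : ℝ) : EReal) := by norm_cast
    rw [e, ← EReal.coe_div, EReal.coe_le_coe_iff]
    calc γ⁻¹ * d k ≤ γ⁻¹ * ((f (x 0) + a 0 - Fstar) / K) :=
          mul_le_mul_of_nonneg_left hle (inv_pos.2 hγ).le
      _ = _ := by field_simp

end
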